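/- Let p be prime, n ≥ pk, and P a partition of [n] with all blocks of size at most p. For any proper coloring c of KG^p(n,k,P) with t colors, the Z_p-equivariant labeling λ constructed from c on the non-empty faces of E_{n-1}(Z_p) (taking the maximal admissible subset B of a face A, and using either (P(A),|B|) when |B| ≤ p(k-1), or (i, c(F)+p(k-1)) when |B| > p(k-1) where F ⊆ B^i is the smallest admissible k-subset) satisfies the hypotheses of the Z_p-Tucker lemma with α = p(k-1) and m = p(k-1)+t; consequently t ≥ (n - p(k-1))/(p-1). -/

import Mathlib

open Finset

/-- A coloring of the vertices is proper if no edge is monochromatic. -/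
def IsProperColoring {V : Type*} (E : Set (Multiset V)) {t : ℕ} (c : V → Fin t) : Prop :=
  ∀ e ∈ E, ∃ a ∈ e, ∃ b ∈ e, c a ≠ c b

/-- The chromatic number of a hypergraph with edge set `E`, as an extended natural number
(infinity if no proper coloring exists). -/
noncomputable def hypChromatic {V : Type*} (E : Set (Multiset V)) : ℕ∞ :=
  sInf {N : ℕ∞ | ∃ t : ℕ, N = (t : ℕ∞) ∧ ∃ c : V → Fin t, IsProperColoring E c}

/-- `P : Fin l → Finset (Fin n)` is a partition of `[n]` into nonempty blocks. -/
def IsPartition (n l : ℕ) (P : Fin l → Finset (Fin n)) : Prop :=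
  (∀ j, (P j).Nonempty) ∧ ∀ x : Fin n, ∃! j, x ∈ P j

/-- Vertices of `KG^r(n,k,P)`: `k`-subsets of `[n]` meeting each block of `P`
in at most one element. -/
def KGPVertex (n k l : ℕ) (P : Fin l → Finset (Fin n)) : Type :=
  {A : Finset (Fin n) // A.card = k ∧ ∀ j, (A ∩ P j).card ≤ 1}

/-- Edges of `KG^r(n,k,P)`: `r`-subsets of vertices that are pairwise disjoint. -/
def KGPEdges (n k l r : ℕ) (P : Fin l → Finset (Fin n)) :
    Set (Multiset (KGPVertex n k l P)) :=
  {e | Multiset.card e = r ∧ e.Nodup ∧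
    ∀ a ∈ e, ∀ b ∈ e, a ≠ b → Disjoint a.1 b.1}

/-- A non-empty face of `E_{n-1}(ℤ_p)`. -/
def IsEFace (p n : ℕ) (A : Finset (ZMod p × Fin n)) : Prop :=
  A.Nonempty ∧ ∀ a ∈ A, ∀ b ∈ A, a.2 = b.2 → a = b

/-- The `ℤ_p`-action on faces, by translation in the first coordinate. -/
def ESmul (p n : ℕ) (ω : ZMod p) (A : Finset (ZMod p × Fin n)) : Finset (ZMod p × Fin n) :=
  A.image (fun x => (ω + x.1, x.2))

/-! ### Alternating boundary of functionals on lists -/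

section Boundary

variable {α β M M' : Type*} [AddCommGroup M] [AddCommGroup M']

/-- The functional `l ↦ ∑ i, (-1)^i F (l with its i-th entry removed)`. -/
def listCobdry : (List α → M) → List α → M
  | _, [] => 0
  | F, a :: l => F l - listCobdry (fun l' => F (a :: l')) l

@[simp] lemma listCobdry_nil (F : List α → M) : listCobdry F [] = 0 := by
  simp [listCobdry]

lemma listCobdry_cons (F : List α → M) (a : α) (l : List α) :
    listCobdry F (a :: l) = F l - listCobdry (fun l' => F (a :: l')) l := by
  simp [listCobdry]

lemma listCobdry_congr {F G : List α → M} {l : List α}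
    (h : ∀ l', l'.Sublist l → F l' = G l') : listCobdry F l = listCobdry G l := by
  induction l generalizing F G with
  | nil => simp
  | cons a l ih =>
    rw [listCobdry_cons, listCobdry_cons, h l (List.sublist_cons_self a l),
      ih fun l' hl' => h _ (hl'.cons_cons a)]

lemma listCobdry_comp {Φ : Type*} [FunLike Φ M M'] [AddMonoidHomClass Φ M M'] (f : Φ)
    (F : List α → M) (l : List α) :
    listCobdry (fun l' => f (F l')) l = f (listCobdry F l) := by
  induction l generalizing F with
  | nil => simp
  | cons a l ih => rw [listCobdry_cons, listCobdry_cons, ih, map_sub]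

lemma listCobdry_zero (l : List α) : listCobdry (fun _ => (0 : M)) l = 0 := by
  simpa using listCobdry_comp (0 : M →+ M) (fun _ => 0) l

lemma listCobdry_neg (F : List α → M) (l : List α) :
    listCobdry (fun l' => -F l') l = -listCobdry F l :=
  listCobdry_comp (negAddMonoidHom : M →+ M) F l

lemma listCobdry_sub (F G : List α → M) (l : List α) :
    listCobdry (fun l' => F l' - G l') l = listCobdry F l - listCobdry G l := by
  induction l generalizing F G with
  | nil => simp
  | cons a l ih => simp only [listCobdry_cons, ih]; abel

lemma listCobdry_sum {ι : Type*} (s : Finset ι) (F : ι → List α → M) (l : List α) :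
    listCobdry (fun l' => ∑ i ∈ s, F i l') l = ∑ i ∈ s, listCobdry (F i) l := by
  induction l generalizing F with
  | nil => simp
  | cons a l ih => simp only [listCobdry_cons, ih, Finset.sum_sub_distrib]

lemma listCobdry_listCobdry (F : List α → M) (l : List α) :
    listCobdry (listCobdry F) l = 0 := by
  induction l generalizing F with
  | nil => simp
  | cons a l ih =>
    rw [listCobdry_cons]
    simp only [listCobdry_cons]
    rw [listCobdry_sub, ih]
    simp

lemma listCobdry_map (f : α → β) (F : List β → M) (l : List α) :
    listCobdry F (l.map f) = listCobdry (fun l' => F (l'.map f)) l := by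
  induction l generalizing F with
  | nil => simp
  | cons a l ih => simp [listCobdry_cons, ih]

/-- `F` is antisymmetric under adjacent swaps and vanishes on adjacent repetitions. -/
def IsAlternatingOnLists (F : List α → M) : Prop :=
  ∀ l₁ a b l₂, F (l₁ ++ a :: b :: l₂) = -F (l₁ ++ b :: a :: l₂) ∧ F (l₁ ++ a :: a :: l₂) = 0

lemma IsAlternatingOnLists.cons {F : List α → M} (hF : IsAlternatingOnLists F) (a : α) :
    IsAlternatingOnLists fun l => F (a :: l) :=
  fun l₁ => hF (a :: l₁)

lemma IsAlternatingOnLists.listCobdry {F : List α → M} (hF : IsAlternatingOnLists F) :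
    IsAlternatingOnLists (listCobdry F) := by
  intro l₁
  induction l₁ generalizing F with
  | nil =>
    intro a b l₂
    have h₁ : (fun l' => F (a :: b :: l')) = fun l' => -F (b :: a :: l') :=
      funext fun l' => (hF [] a b l').1
    have h₂ : (fun l' => F (a :: a :: l')) = fun _ => 0 :=
      funext fun l' => (hF [] a b l').2
    simp only [List.nil_append, listCobdry_cons, h₁, h₂, listCobdry_neg, listCobdry_zero]
    constructor <;> abel
  | cons c l₁ ih =>
    intro a b l₂
    obtain ⟨h₁, h₂⟩ := ih (hF.cons c) a b l₂
    simp only [List.cons_append, listCobdry_cons, h₁, h₂, (hF l₁ a b l₂).1, (hF l₁ a b l₂).2]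
    constructor <;> abel

lemma IsAlternatingOnLists.perm {F : List α → M} (hF : IsAlternatingOnLists F)
    {l l' : List α} (h : l.Perm l') : F l = F l' ∨ F l = -F l' := by
  induction h generalizing F with
  | nil => exact Or.inl rfl
  | cons a _ ih => exact ih (hF.cons a)
  | swap a b l => exact Or.inr (hF [] b a l).1
  | trans _ _ ih₁ ih₂ =>
    rcases ih₁ hF with h₁ | h₁ <;> rcases ih₂ hF with h₂ | h₂ <;> simp [h₁, h₂]

lemma IsAlternatingOnLists.eq_zero {F : List α → M} (hF : IsAlternatingOnLists F)
    {l : List α} (h : ¬ l.Nodup) : F l = 0 := by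
  rw [List.nodup_iff_sublist] at h
  push Not at h
  obtain ⟨a, ha⟩ := h
  obtain ⟨l', hl'⟩ := ha.exists_perm_append
  have h0 : F ([a, a] ++ l') = 0 := (hF [] a a l').2
  rcases hF.perm hl' with h | h <;> rw [h, h0]
  exact neg_zero

/-- Pullback of a functional along barycentric subdivision of ordered simplices:
a simplex `l` is coned off from its vertex set. -/
def subdivide [DecidableEq α] : ℕ → (List (Finset α) → M) → List α → M
  | 0, Φ, _ => Φ []
  | n + 1, Φ, l => listCobdry (subdivide n fun L => Φ (l.toFinset :: L)) l

lemma subdivide_congr [DecidableEq α] {n : ℕ} {Φ Ψ : List (Finset α) → M} {l : List α}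
    (h : ∀ L : List (Finset α), L.length = n → L.Pairwise (fun s t => t ⊆ s) →
      (∀ s ∈ L, s.Nonempty ∧ s ⊆ l.toFinset) → Φ L = Ψ L) :
    subdivide n Φ l = subdivide n Ψ l := by
  induction n generalizing Φ Ψ l with
  | zero => exact h [] rfl List.Pairwise.nil (by simp)
  | succ n ih =>
    rcases l.eq_nil_or_concat with rfl | ⟨l₀, x, rfl⟩
    · simp [subdivide]
    set l := l₀.concat x
    refine listCobdry_congr fun l' hl' => ih fun L hL hP hs => h _ (by simp [hL]) ?_ ?_
    · refine List.pairwise_cons.2 ⟨fun s hsL => (hs s hsL).2.trans ?_, hP⟩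
      intro y hy
      simpa using hl'.subset (by simpa using hy)
    · intro s hsL
      rcases List.mem_cons.1 hsL with rfl | hsL
      · exact ⟨⟨x, by simp [l]⟩, subset_rfl⟩
      · refine ⟨(hs s hsL).1, (hs s hsL).2.trans fun y hy => ?_⟩
        simpa using hl'.subset (by simpa using hy)

lemma subdivide_comp [DecidableEq α] {Θ : Type*} [FunLike Θ M M'] [AddMonoidHomClass Θ M M']
    (f : Θ) (n : ℕ) (Φ : List (Finset α) → M) (l : List α) :
    subdivide n (fun L => f (Φ L)) l = f (subdivide n Φ l) := by
  induction n generalizing Φ l with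
  | zero => rfl
  | succ n ih =>
    simp only [subdivide]
    rw [← listCobdry_comp]
    exact listCobdry_congr fun l' _ => ih _ _

lemma subdivide_sub [DecidableEq α] (n : ℕ) (Φ Ψ : List (Finset α) → M) (l : List α) :
    subdivide n (fun L => Φ L - Ψ L) l = subdivide n Φ l - subdivide n Ψ l := by
  induction n generalizing Φ Ψ l with
  | zero => rfl
  | succ n ih =>
    simp only [subdivide]
    rw [← listCobdry_sub]
    exact listCobdry_congr fun l' _ => ih _ _ _

lemma subdivide_listCobdry [DecidableEq α] (n : ℕ) (Φ : List (Finset α) → M) (l : List α) :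
    subdivide (n + 1) (listCobdry Φ) l = listCobdry (subdivide n Φ) l := by
  induction n generalizing Φ l with
  | zero => simp [subdivide, listCobdry_cons]
  | succ n ih =>
    rw [subdivide]
    have h : ∀ l', subdivide (n + 1) (fun L => listCobdry Φ (l.toFinset :: L)) l' =
        subdivide (n + 1) Φ l' -
          listCobdry (subdivide n fun L => Φ (l.toFinset :: L)) l' := fun l' => by
      simp only [listCobdry_cons]
      rw [subdivide_sub, ← ih]
    rw [listCobdry_congr fun l' _ => h l', listCobdry_sub, listCobdry_listCobdry, sub_zero]

lemma subdivide_map [DecidableEq α] [DecidableEq β] (f : α → β) (n : ℕ)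
    (Φ : List (Finset β) → M) (l : List α) :
    subdivide n Φ (l.map f) = subdivide n (fun L => Φ (L.map (Finset.image f))) l := by
  induction n generalizing Φ l with
  | zero => rfl
  | succ n ih =>
    simp only [subdivide]
    rw [listCobdry_map]
    refine listCobdry_congr fun l' _ => ?_
    rw [ih]
    simp only [List.map_cons]
    congr! 4
    ext
    simp

end Boundary

/-! ### The periodic complex of the cyclic group -/

section Cyclic

variable {p : ℕ}

/-- Translation of functions on `ZMod p`. -/
def rotate (a : ZMod p) : (ZMod p → ZMod p) →ₗ[ZMod p] (ZMod p → ZMod p) :=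
  LinearMap.funLeft _ _ (· - a)

@[simp] lemma rotate_apply (a : ZMod p) (r : ZMod p → ZMod p) (x : ZMod p) :
    rotate a r x = r (x - a) := rfl

lemma rotate_rotate (a b : ZMod p) (r : ZMod p → ZMod p) :
    rotate a (rotate b r) = rotate (a + b) r := by
  ext x; simp [sub_sub]

lemma rotate_zero (r : ZMod p → ZMod p) : rotate 0 r = r := by
  ext x; simp

variable [NeZero p]

/-- The differentials of the periodic complex: the norm in even degrees and `g - 1`
in odd degrees. -/
def cyclicDiff (p : ℕ) [NeZero p] (n : ℕ) : (ZMod p → ZMod p) →ₗ[ZMod p] (ZMod p → ZMod p) :=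
  if Even n then ∑ a, rotate a else rotate 1 - LinearMap.id

lemma cyclicDiff_even {n : ℕ} (hn : Even n) (r : ZMod p → ZMod p) (x : ZMod p) :
    cyclicDiff p n r x = ∑ y, r y := by
  simpa [cyclicDiff, hn] using (Equiv.subLeft x).sum_comp r

lemma cyclicDiff_odd {n : ℕ} (hn : ¬ Even n) (r : ZMod p → ZMod p) (x : ZMod p) :
    cyclicDiff p n r x = r (x - 1) - r x := by
  simp [cyclicDiff, hn]

lemma cyclicDiff_add_two (n : ℕ) : cyclicDiff p (n + 2) = cyclicDiff p n := by
  simp [cyclicDiff, Nat.even_add]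

lemma cyclicDiff_rotate (n : ℕ) (a : ZMod p) (r : ZMod p → ZMod p) :
    cyclicDiff p n (rotate a r) = rotate a (cyclicDiff p n r) := by
  ext x
  by_cases hn : Even n
  · simpa [cyclicDiff_even hn] using (Equiv.subRight a).sum_comp r
  · simp [cyclicDiff_odd hn, sub_right_comm]

lemma eq_const_of_cyclicDiff_odd {n : ℕ} (hn : ¬ Even n) {r : ZMod p → ZMod p}
    (h : cyclicDiff p n r = 0) (x : ZMod p) : r x = r 0 := by
  have key : ∀ m : ℕ, r (m : ZMod p) = r 0 := by
    intro m
    induction m with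
    | zero => simp
    | succ m ih =>
      have := congrFun h ((m + 1 : ℕ) : ZMod p)
      rw [cyclicDiff_odd hn] at this
      rw [← ih]
      exact (sub_eq_zero.1 (by simpa using this)).symm
  simpa using key x.val

lemma cyclicDiff_zero_of_cyclicDiff {n : ℕ} {r : ZMod p → ZMod p}
    (h : cyclicDiff p n r = 0) : cyclicDiff p 0 r = 0 := by
  ext x
  by_cases hn : Even n
  · have := congrFun h x
    rwa [cyclicDiff_even hn, ← cyclicDiff_even (p := p) Even.zero r x] at this
  · rw [cyclicDiff_even Even.zero,
      Finset.sum_congr rfl fun y _ => eq_const_of_cyclicDiff_odd hn h y]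
    simp [ZMod.card]

/-- A linear section of `cyclicDiff p n` over the kernel of `cyclicDiff p (n + 1)`. -/
def cyclicSection (p : ℕ) [NeZero p] (n : ℕ) :
    (ZMod p → ZMod p) →ₗ[ZMod p] (ZMod p → ZMod p) :=
  if Even n then LinearMap.single (ZMod p) (fun _ => ZMod p) 0 ∘ₗ LinearMap.proj 0
  else LinearMap.pi fun x => -∑ i ∈ range (x.val + 1), LinearMap.proj (i : ZMod p)

lemma sum_range_natCast (r : ZMod p → ZMod p) :
    ∑ i ∈ range p, r (i : ZMod p) = ∑ y, r y := by
  refine Finset.sum_bij (fun i _ => (i : ZMod p)) (by simp) ?_ ?_ (by simp)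
  · intro a ha b hb h
    rw [ZMod.natCast_eq_natCast_iff'] at h
    rwa [Nat.mod_eq_of_lt (mem_range.1 ha), Nat.mod_eq_of_lt (mem_range.1 hb)] at h
  · exact fun y _ => ⟨y.val, mem_range.2 y.val_lt, by simp⟩

lemma cyclicDiff_cyclicSection {n : ℕ} {r : ZMod p → ZMod p}
    (h : cyclicDiff p (n + 1) r = 0) : cyclicDiff p n (cyclicSection p n r) = r := by
  ext x
  by_cases hn : Even n
  · have h1 : ¬ Even (n + 1) := by simpa [Nat.even_add_one] using hn
    rw [cyclicDiff_even hn, eq_const_of_cyclicDiff_odd h1 h x]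
    simp [cyclicSection, hn]
  · have h1 : Even (n + 1) := by simpa [Nat.even_add_one] using hn
    have hs : ∑ y, r y = 0 := by simpa [cyclicDiff_even h1] using congrFun h 0
    have hS : ∀ y, cyclicSection p n r y = -∑ i ∈ range (y.val + 1), r (i : ZMod p) := by
      intro y; simp [cyclicSection, hn]
    rw [cyclicDiff_odd hn, hS, hS]
    by_cases hx : x = 0
    · subst hx
      obtain ⟨q, hq⟩ : ∃ q, p = q + 1 := ⟨p - 1, (Nat.succ_pred (NeZero.ne p)).symm⟩
      subst hq
      rw [zero_sub, ZMod.val_neg_one, sum_range_natCast, hs]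
      simp
    · have hv : (x - 1).val + 1 = x.val := by
        have hpos : 0 < x.val := Nat.pos_of_ne_zero (by simpa [ZMod.val_eq_zero] using hx)
        have : x - 1 = ((x.val - 1 : ℕ) : ZMod p) := by
          rw [Nat.cast_sub hpos]; simp
        rw [this, ZMod.val_natCast, Nat.mod_eq_of_lt (by have := x.val_lt; omega)]
        omega
      rw [hv, Finset.sum_range_succ]
      simp

/-- The equivariant chain map from ordered simplices to the periodic complex determined by a
sign function `g`. -/
def cyclicCochain {α : Type*} (g : List α → ZMod p) : ℕ → List α → ZMod p → ZMod p
  | 0, [] => 1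
  | 0, _ :: _ => 0
  | n + 1, l => rotate (g l) (cyclicSection p n
      (rotate (-g l) (listCobdry (cyclicCochain g n) l)))

variable {α : Type*} (g : List α → ZMod p)

lemma cyclicDiff_cyclicCochain (n : ℕ) (l : List α) :
    cyclicDiff p n (cyclicCochain g (n + 1) l) = listCobdry (cyclicCochain g n) l := by
  have h : cyclicDiff p (n + 1) (listCobdry (cyclicCochain g n) l) = 0 := by
    induction n generalizing l with
    | zero =>
      have h0 : ∀ l : List α, cyclicDiff p 1 (cyclicCochain g 0 l) = 0 := by
        intro l
        ext x
        cases l <;> simp [cyclicCochain, cyclicDiff_odd]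
      rw [← listCobdry_comp, listCobdry_congr fun l' _ => h0 l', listCobdry_zero]
    | succ n ih =>
      have h1 : ∀ l : List α, cyclicDiff p (n + 2) (cyclicCochain g (n + 1) l) =
          listCobdry (cyclicCochain g n) l := by
        intro l
        rw [cyclicDiff_add_two, cyclicCochain, cyclicDiff_rotate, cyclicDiff_cyclicSection,
          rotate_rotate, add_neg_cancel, rotate_zero]
        rw [cyclicDiff_rotate, ih, map_zero]
      rw [← listCobdry_comp, listCobdry_congr fun l' _ => h1 l', listCobdry_listCobdry]
  rw [cyclicCochain, cyclicDiff_rotate, cyclicDiff_cyclicSection,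
    rotate_rotate, add_neg_cancel, rotate_zero]
  rw [cyclicDiff_rotate, h, map_zero]

lemma cyclicCochain_map (φ : α → α) (a : ZMod p) (n : ℕ) (l : List α)
    (h : ∀ l', l' ≠ [] → l'.Sublist l → g (l'.map φ) = a + g l') :
    cyclicCochain g n (l.map φ) = rotate a (cyclicCochain g n l) := by
  induction n generalizing l with
  | zero =>
    cases l
    · ext; simp [cyclicCochain]
    · simp [cyclicCochain]
  | succ n ih =>
    rcases eq_or_ne l [] with rfl | hl
    · simp [cyclicCochain]
    rw [cyclicCochain, cyclicCochain, h l hl (List.Sublist.refl l), listCobdry_map,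
      listCobdry_congr fun l' hl' => ih l' fun l'' h0 hl'' => h l'' h0 (hl''.trans hl'),
      listCobdry_comp, rotate_rotate, rotate_rotate, show -(a + g l) + a = -g l by ring]

lemma isAlternatingOnLists_cyclicCochain (hg : ∀ l l' : List α, l.Perm l' → g l = g l')
    (n : ℕ) : IsAlternatingOnLists (cyclicCochain g n) := by
  induction n with
  | zero => intro l₁ a b l₂; cases l₁ <;> simp [cyclicCochain]
  | succ n ih =>
    intro l₁ a b l₂
    obtain ⟨h₁, h₂⟩ := ih.listCobdry l₁ a b l₂
    rw [cyclicCochain, cyclicCochain, cyclicCochain, h₁, h₂,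
      hg _ _ ((List.Perm.swap b a l₂).append_left l₁)]
    simp

end Cyclic

/-! ### Fundamental chains in the iterated join of `ZMod p` -/

section Join

variable {p : ℕ} {ι M M' : Type*} [AddCommGroup M] [AddCommGroup M']

/-- Translation in the first coordinate. -/
def shift (a : ZMod p) (x : ZMod p × ι) : ZMod p × ι := (a + x.1, x.2)

@[simp] lemma shift_fst (a : ZMod p) (x : ZMod p × ι) : (shift a x).1 = a + x.1 := rfl

@[simp] lemma shift_snd (a : ZMod p) (x : ZMod p × ι) : (shift a x).2 = x.2 := rfl

lemma shift_injective (a : ZMod p) : Function.Injective (shift a : ZMod p × ι → ZMod p × ι) := by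
  rintro ⟨x, i⟩ ⟨y, j⟩ h
  simpa [shift] using h

lemma map_shift_shift (a b : ZMod p) (l : List (ZMod p × ι)) :
    (l.map (shift a)).map (shift b) = l.map (shift (b + a)) := by
  simp [Function.comp_def, shift, add_assoc]

lemma map_snd_map_shift (a : ZMod p) (l : List (ZMod p × ι)) :
    (l.map (shift a)).map Prod.snd = l.map Prod.snd := by
  simp [Function.comp_def]

variable [NeZero p]

/-- The analogue of `cyclicDiff` on functionals on lists. -/
def shiftDiff (n : ℕ) (Ψ : List (ZMod p × ι) → M) (l : List (ZMod p × ι)) : M :=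
  if Even n then ∑ a, Ψ (l.map (shift a)) else Ψ (l.map (shift 1)) - Ψ l

lemma shiftDiff_even {n : ℕ} (hn : Even n) (Ψ : List (ZMod p × ι) → M) (l : List (ZMod p × ι)) :
    shiftDiff n Ψ l = ∑ a, Ψ (l.map (shift a)) := if_pos hn

lemma shiftDiff_odd {n : ℕ} (hn : ¬ Even n) (Ψ : List (ZMod p × ι) → M)
    (l : List (ZMod p × ι)) : shiftDiff n Ψ l = Ψ (l.map (shift 1)) - Ψ l := if_neg hn

lemma shiftDiff_sub (n : ℕ) (Ψ Φ : List (ZMod p × ι) → M) :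
    shiftDiff n (fun l => Ψ l - Φ l) = fun l => shiftDiff n Ψ l - shiftDiff n Φ l := by
  ext l
  by_cases hn : Even n
  · simp [shiftDiff_even hn]
  · simp only [shiftDiff_odd hn]; abel

lemma shiftDiff_comp {Θ : Type*} [FunLike Θ M M'] [AddMonoidHomClass Θ M M'] (f : Θ) (n : ℕ)
    (Ψ : List (ZMod p × ι) → M) :
    shiftDiff n (fun l => f (Ψ l)) = fun l => f (shiftDiff n Ψ l) := by
  ext l
  by_cases hn : Even n
  · simp [shiftDiff_even hn]
  · simp [shiftDiff_odd hn]

lemma shiftDiff_listCobdry (n : ℕ) (Ψ : List (ZMod p × ι) → M) :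
    shiftDiff n (listCobdry Ψ) = listCobdry (shiftDiff n Ψ) := by
  ext l
  by_cases hn : Even n
  · rw [shiftDiff_even hn, funext (shiftDiff_even hn Ψ), listCobdry_sum]
    simp only [listCobdry_map]
  · rw [shiftDiff_odd hn, funext (shiftDiff_odd hn Ψ), listCobdry_sub]
    simp only [listCobdry_map]

lemma shiftDiff_shiftDiff (n : ℕ) (Ψ : List (ZMod p × ι) → M) :
    shiftDiff n (shiftDiff (n + 1) Ψ) = fun _ => 0 := by
  ext l
  by_cases hn : Even n
  · have h1 : ¬ Even (n + 1) := by simpa [Nat.even_add_one] using hn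
    simp only [shiftDiff_even hn, shiftDiff_odd h1, map_shift_shift, Finset.sum_sub_distrib]
    rw [sub_eq_zero]
    exact Equiv.sum_comp (Equiv.addLeft (1 : ZMod p)) fun a => Ψ (l.map (shift a))
  · have h1 : Even (n + 1) := by simpa [Nat.even_add_one] using hn
    simp only [shiftDiff_odd hn, shiftDiff_even h1, map_shift_shift]
    rw [sub_eq_zero]
    exact Equiv.sum_comp (Equiv.addRight (1 : ZMod p)) fun a => Ψ (l.map (shift a))

/-- Evaluation of a functional on the fundamental chain of the join of the copies of `ZMod p`
indexed by `w 0, …, w q`. -/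
def joinEval (w : ℕ → ι) : ℕ → (List (ZMod p × ι) → M) → M
  | 0, Ψ => Ψ [(0, w 0)]
  | q + 1, Ψ => joinEval w q (shiftDiff (q + 1) fun l => Ψ ((0, w (q + 1)) :: l))

lemma joinEval_congr (w : ℕ → ι) (q : ℕ) {Ψ Φ : List (ZMod p × ι) → M}
    (h : ∀ l : List (ZMod p × ι), l.length = q + 1 →
      l.map Prod.snd = ((List.range (q + 1)).map w).reverse → Ψ l = Φ l) :
    joinEval w q Ψ = joinEval w q Φ := by
  induction q generalizing Ψ Φ with
  | zero => exact h _ rfl rfl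
  | succ q ih =>
    refine ih fun l hlen hl => ?_
    have key : ∀ a, Ψ ((0, w (q + 1)) :: l.map (shift a)) =
        Φ ((0, w (q + 1)) :: l.map (shift a)) := fun a =>
      h _ (by simp [hlen]) (by
        rw [List.map_cons, map_snd_map_shift, hl, List.range_succ (n := q + 1)]
        simp)
    have key0 : Ψ ((0, w (q + 1)) :: l) = Φ ((0, w (q + 1)) :: l) := by
      have h0 : l.map (shift (0 : ZMod p)) = l := by
        convert l.map_id using 2
        ext x <;> simp
      simpa [h0] using key 0
    simp only [shiftDiff, key, key0]

lemma joinEval_sub (w : ℕ → ι) (q : ℕ) (Ψ Φ : List (ZMod p × ι) → M) :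
    joinEval w q (fun l => Ψ l - Φ l) = joinEval w q Ψ - joinEval w q Φ := by
  induction q generalizing Ψ Φ with
  | zero => rfl
  | succ q ih => simp only [joinEval, shiftDiff_sub, ih]

lemma joinEval_zero (w : ℕ → ι) (q : ℕ) :
    joinEval w q (fun _ : List (ZMod p × ι) => (0 : M)) = 0 := by
  simpa using joinEval_sub w q (fun _ : List (ZMod p × ι) => (0 : M)) fun _ => 0

lemma joinEval_comp {Θ : Type*} [FunLike Θ M M'] [AddMonoidHomClass Θ M M'] (f : Θ)
    (w : ℕ → ι) (q : ℕ) (Ψ : List (ZMod p × ι) → M) :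
    joinEval w q (fun l => f (Ψ l)) = f (joinEval w q Ψ) := by
  induction q generalizing Ψ with
  | zero => rfl
  | succ q ih => simp only [joinEval, shiftDiff_comp, ih]

lemma joinEval_listCobdry (w : ℕ → ι) (q : ℕ) (Ψ : List (ZMod p × ι) → M) :
    joinEval w (q + 1) (listCobdry Ψ) = joinEval w q (shiftDiff (q + 1) Ψ) := by
  induction q generalizing Ψ with
  | zero =>
    simp only [joinEval, listCobdry_cons, shiftDiff_sub]
    rw [sub_eq_self]
    simp [shiftDiff_odd, listCobdry_cons]
  | succ q ih =>
    rw [joinEval]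
    simp only [listCobdry_cons, shiftDiff_sub]
    rw [joinEval_sub, sub_eq_self]
    change joinEval w (q + 1) (shiftDiff (q + 1 + 1)
      (listCobdry fun l => Ψ ((0, w (q + 1 + 1)) :: l))) = 0
    rw [shiftDiff_listCobdry, ih, shiftDiff_shiftDiff, joinEval_zero]

end Join

/-! ### An equivariant sign for sets of labels -/

section Sign

variable {p : ℕ}

/-- The smallest second coordinate of an element of `s`. -/
noncomputable def bottomIndex (s : Finset (ZMod p × ℕ)) : ℕ :=
  sInf {j | ∃ y ∈ s, y.2 = j}

/-- The elements of `s` with the smallest second coordinate. -/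
noncomputable def bottomFiber (s : Finset (ZMod p × ℕ)) : Finset (ZMod p × ℕ) :=
  s.filter fun x => x.2 = bottomIndex s

lemma exists_mem_eq_bottomIndex {s : Finset (ZMod p × ℕ)} (hs : s.Nonempty) :
    ∃ x ∈ s, x.2 = bottomIndex s :=
  Nat.sInf_mem (s := {j | ∃ y ∈ s, y.2 = j}) (hs.elim fun x hx => ⟨x.2, x, hx, rfl⟩)

lemma bottomIndex_shift (a : ZMod p) (s : Finset (ZMod p × ℕ)) :
    bottomIndex (s.image (shift a)) = bottomIndex s := by
  simp only [bottomIndex, Finset.exists_mem_image, shift_snd]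

lemma bottomFiber_shift (a : ZMod p) (s : Finset (ZMod p × ℕ)) :
    bottomFiber (s.image (shift a)) = (bottomFiber s).image (shift a) := by
  simp only [bottomFiber, Finset.filter_image, bottomIndex_shift, shift_snd]
  rfl

/-- The average of the first coordinates of the bottom fiber. -/
noncomputable def averageSign (s : Finset (ZMod p × ℕ)) : ZMod p :=
  (#(bottomFiber s) : ZMod p)⁻¹ * ∑ x ∈ bottomFiber s, x.1

lemma averageSign_shift [Fact p.Prime] (a : ZMod p) {s : Finset (ZMod p × ℕ)} (hs : s.Nonempty)
    (h : #(bottomFiber s) < p) : averageSign (s.image (shift a)) = a + averageSign s := by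
  have h0 : (#(bottomFiber s) : ZMod p) ≠ 0 := by
    rw [Ne, ZMod.natCast_eq_zero_iff]
    refine Nat.not_dvd_of_pos_of_lt (Finset.card_pos.2 ?_) h
    obtain ⟨x, hx, hxs⟩ := exists_mem_eq_bottomIndex hs
    exact ⟨x, Finset.mem_filter.2 ⟨hx, hxs⟩⟩
  rw [averageSign, bottomFiber_shift, Finset.card_image_of_injective _ (shift_injective a),
    Finset.sum_image (shift_injective a).injOn]
  simp only [shift_fst, Finset.sum_add_distrib, Finset.sum_const, nsmul_eq_mul, averageSign]
  field_simp

end Sign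

/-! ### The `ℤ_p`-Tucker lemma -/

section Tucker

variable {p n α t : ℕ} {lam : Finset (ZMod p × Fin n) → ZMod p × ℕ}

lemma exists_monotone_perm_of_chain {β : Type*} {m : ℕ} (A : Fin m → Finset β)
    (h : ∀ i j, A i ⊆ A j ∨ A j ⊆ A i) :
    ∃ σ : Equiv.Perm (Fin m), ∀ i j, i ≤ j → A (σ i) ⊆ A (σ j) := by
  refine ⟨Tuple.sort fun i => #(A i), fun i j hij => ?_⟩
  rcases h (Tuple.sort (fun i => #(A i)) i) (Tuple.sort (fun i => #(A i)) j) with h | h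
  · exact h
  · exact (Finset.eq_of_subset_of_card_le h
      (Tuple.monotone_sort (fun i => #(A i)) hij)).symm.subset

lemma card_label_fiber_le_one {C : Finset (Finset (ZMod p × Fin n))}
    (hC : ∀ A ∈ C, IsEFace p n A) (hchain : ∀ A ∈ C, ∀ B ∈ C, A ⊆ B ∨ B ⊆ A)
    (hlow : ∀ A₁ A₂, IsEFace p n A₁ → IsEFace p n A₂ → A₁ ⊆ A₂ →
        (lam A₁).2 = (lam A₂).2 → (lam A₁).2 ≤ α → (lam A₁).1 = (lam A₂).1)
    {j : ℕ} (hj : j ≤ α) : #((C.image lam).filter fun x => x.2 = j) ≤ 1 := by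
  rw [Finset.card_le_one]
  simp only [Finset.mem_filter, Finset.mem_image]
  rintro _ ⟨⟨A, hA, rfl⟩, hAj⟩ _ ⟨⟨B, hB, rfl⟩, hBj⟩
  refine Prod.ext ?_ (hAj.trans hBj.symm)
  rcases hchain A hA B hB with h | h
  · exact hlow A B (hC A hA) (hC B hB) h (hAj.trans hBj.symm) (hAj.trans_le hj)
  · exact (hlow B A (hC B hB) (hC A hA) h (hBj.trans hAj.symm) (hBj.trans_le hj)).symm

lemma card_le_of_card_fiber_le {s : Finset (ZMod p × ℕ)}
    (hs : ∀ x ∈ s, 1 ≤ x.2 ∧ x.2 ≤ α + t)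
    (h₁ : ∀ j ≤ α, #(s.filter fun x => x.2 = j) ≤ 1)
    (h₂ : ∀ j, #(s.filter fun x => x.2 = j) < p) : #s ≤ α + t * (p - 1) := by
  have hmaps : ∀ x ∈ s, x.2 - 1 ∈ range (α + t) := fun x hx => by
    have := hs x hx
    simp only [Finset.mem_range]; omega
  rw [Finset.card_eq_sum_card_fiberwise hmaps, Finset.sum_range_add]
  have hfib : ∀ j, #(s.filter fun x => x.2 - 1 = j) ≤ #(s.filter fun x => x.2 = j + 1) := by
    intro j
    refine Finset.card_le_card fun x hx => ?_
    simp only [Finset.mem_filter] at hx ⊢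
    have := hs x hx.1
    exact ⟨hx.1, by omega⟩
  refine add_le_add ?_ ?_
  · refine (Finset.sum_le_card_nsmul _ _ 1 fun j hj => (hfib j).trans (h₁ _ ?_)).trans (by simp)
    simpa [Nat.succ_le_iff] using hj
  · refine (Finset.sum_le_card_nsmul _ _ (p - 1) fun j _ => (hfib _).trans ?_).trans (by simp)
    exact Nat.le_sub_one_of_lt (h₂ _)

lemma isEFace_of_subset_toFinset {l : List (ZMod p × Fin n)} (hl : (l.map Prod.snd).Nodup)
    {A : Finset (ZMod p × Fin n)} (hA : A.Nonempty) (h : A ⊆ l.toFinset) : IsEFace p n A :=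
  ⟨hA, fun _ ha _ hb hab => List.inj_on_of_nodup_map hl (List.mem_toFinset.1 (h ha))
    (List.mem_toFinset.1 (h hb)) hab⟩

variable [hp : Fact p.Prime]

lemma card_label_fiber_lt {C : Finset (Finset (ZMod p × Fin n))}
    (hC : ∀ A ∈ C, IsEFace p n A) (hchain : ∀ A ∈ C, ∀ B ∈ C, A ⊆ B ∨ B ⊆ A)
    (hlow : ∀ A₁ A₂, IsEFace p n A₁ → IsEFace p n A₂ → A₁ ⊆ A₂ →
        (lam A₁).2 = (lam A₂).2 → (lam A₁).2 ≤ α → (lam A₁).1 = (lam A₂).1)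
    (hhigh : ∀ A : Fin p → Finset (ZMod p × Fin n),
        (∀ j, IsEFace p n (A j)) → (∀ i j, i ≤ j → A i ⊆ A j) →
        (∀ i j, (lam (A i)).2 = (lam (A j)).2) → (∀ j, α < (lam (A j)).2) →
        ¬ Function.Injective (fun j => (lam (A j)).1))
    (j : ℕ) : #((C.image lam).filter fun x => x.2 = j) < p := by
  rcases le_or_gt j α with hj | hj
  · exact (card_label_fiber_le_one hC hchain hlow hj).trans_lt hp.out.one_lt
  by_contra! hcard
  have hinj : Set.InjOn Prod.fst
      ((C.image lam).filter fun x => x.2 = j : Set (ZMod p × ℕ)) := by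
    intro x hx y hy h
    simp only [Finset.coe_filter, Set.mem_ofPred_eq] at hx hy
    exact Prod.ext h (hx.2.trans hy.2.symm)
  have huniv : ((C.image lam).filter fun x => x.2 = j).image Prod.fst = univ := by
    rw [← Finset.card_eq_iff_eq_univ, ZMod.card]
    refine le_antisymm ((Finset.card_le_univ _).trans_eq (ZMod.card p)) ?_
    rwa [Finset.card_image_of_injOn hinj]
  have hex : ∀ i : ZMod p, ∃ A ∈ C, lam A = (i, j) := by
    intro i
    have hi := Finset.mem_univ i
    rw [← huniv] at hi
    simp only [Finset.mem_image, Finset.mem_filter] at hi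
    obtain ⟨x, ⟨⟨A, hA, rfl⟩, hx⟩, rfl⟩ := hi
    exact ⟨A, hA, Prod.ext rfl hx⟩
  choose A hAC hA using hex
  let e : Fin p ≃ ZMod p := (Fintype.equivFinOfCardEq (ZMod.card p)).symm
  obtain ⟨σ, hσ⟩ := exists_monotone_perm_of_chain (fun i => A (e i))
    fun i k => hchain _ (hAC _) _ (hAC _)
  refine hhigh (fun i => A (e (σ i))) (fun i => hC _ (hAC _)) hσ (by simp [hA]) (by simp [hA, hj])
    ?_
  simp only [hA]
  exact e.injective.comp σ.injective

/-- The `ℤ_p`-Tucker lemma. -/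
theorem le_of_zmod_tucker_labeling
    (hrange : ∀ A, IsEFace p n A → 1 ≤ (lam A).2 ∧ (lam A).2 ≤ α + t)
    (hequiv : ∀ ω : ZMod p, ∀ A, IsEFace p n A →
        lam (ESmul p n ω A) = (ω + (lam A).1, (lam A).2))
    (hlow : ∀ A₁ A₂, IsEFace p n A₁ → IsEFace p n A₂ → A₁ ⊆ A₂ →
        (lam A₁).2 = (lam A₂).2 → (lam A₁).2 ≤ α → (lam A₁).1 = (lam A₂).1)
    (hhigh : ∀ A : Fin p → Finset (ZMod p × Fin n),
        (∀ j, IsEFace p n (A j)) → (∀ i j, i ≤ j → A i ⊆ A j) →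
        (∀ i j, (lam (A i)).2 = (lam (A j)).2) → (∀ j, α < (lam (A j)).2) →
        ¬ Function.Injective (fun j => (lam (A j)).1)) :
    n ≤ α + t * (p - 1) := by
  by_contra! hlt
  have hn : 0 < n := by omega
  let w : ℕ → Fin n := fun q => ⟨q % n, Nat.mod_lt q hn⟩
  have hw : ∀ q < n, (((List.range (q + 1)).map w).reverse).Nodup := by
    intro q hq
    rw [List.nodup_reverse]
    refine List.Nodup.map_on (fun x hx y hy hxy => ?_) List.nodup_range
    simp only [List.mem_range] at hx hy
    simpa [w, Nat.mod_eq_of_lt (show x < n by omega), Nat.mod_eq_of_lt (show y < n by omega)]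
      using hxy
  let g : List (ZMod p × ℕ) → ZMod p := fun l => averageSign l.toFinset
  let Φ : ℕ → List (Finset (ZMod p × Fin n)) → ZMod p → ZMod p :=
    fun q L => cyclicCochain g (q + 1) (L.map lam)
  let Ψ : ℕ → List (ZMod p × Fin n) → ZMod p → ZMod p := fun q => subdivide (q + 1) (Φ q)
  have hchain : ∀ L : List (Finset (ZMod p × Fin n)), L.Pairwise (fun s t => t ⊆ s) →
      ∀ A ∈ L.toFinset, ∀ B ∈ L.toFinset, A ⊆ B ∨ B ⊆ A := by
    intro L hL A hA B hB
    have : Std.Symm fun A B : Finset (ZMod p × Fin n) => A ⊆ B ∨ B ⊆ A := ⟨fun _ _ => Or.symm⟩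
    exact List.Pairwise.forall_of_forall (R := fun A B => A ⊆ B ∨ B ⊆ A)
      (fun _ _ => Or.inl subset_rfl) (hL.imp fun h => Or.inr h)
      (List.mem_toFinset.1 hA) (List.mem_toFinset.1 hB)
  have hΨdiff : ∀ q l, cyclicDiff p (q + 1) (Ψ (q + 1) l) = listCobdry (Ψ q) l := by
    intro q l
    rw [← subdivide_listCobdry, ← subdivide_comp]
    congr 1
    ext1 L
    rw [cyclicDiff_cyclicCochain, listCobdry_map]
  have hΨshift : ∀ q < n, ∀ l : List (ZMod p × Fin n),
      l.map Prod.snd = ((List.range (q + 1)).map w).reverse → ∀ a,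
      Ψ q (l.map (shift a)) = rotate a (Ψ q l) := by
    intro q hq l hl a
    simp only [Ψ]
    rw [subdivide_map, ← subdivide_comp]
    refine subdivide_congr fun L _ hL hLl => ?_
    have hface : ∀ A ∈ L.toFinset, IsEFace p n A := fun A hA =>
      isEFace_of_subset_toFinset (hl ▸ hw q hq) (hLl A (List.mem_toFinset.1 hA)).1
        (hLl A (List.mem_toFinset.1 hA)).2
    have hmap : (L.map (Finset.image (shift a))).map lam = (L.map lam).map (shift a) := by
      rw [List.map_map, List.map_map]
      exact List.map_congr_left fun A hA => hequiv a A (hface A (List.mem_toFinset.2 hA))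
    simp only [Φ]
    rw [hmap]
    refine cyclicCochain_map g _ a _ _ fun l' hne hl' => ?_
    have hg : (l'.map (shift a)).toFinset = l'.toFinset.image (shift a) := by ext; simp
    have hne' : l'.toFinset.Nonempty := by simpa using hne
    simp only [g]
    rw [hg, averageSign_shift a hne']
    refine (Finset.card_le_card (Finset.filter_subset_filter _ fun y hy => ?_)).trans_lt
      (card_label_fiber_lt hface (hchain L hL) hlow hhigh (bottomIndex l'.toFinset))
    simpa using hl'.subset (List.mem_toFinset.1 hy)
  have hnorm : ∀ q < n, cyclicDiff p 0 (joinEval w q (Ψ q)) = 1 := by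
    intro q
    induction q with
    | zero =>
      intro _
      simp only [joinEval, Ψ, Φ, subdivide, listCobdry_cons, listCobdry_nil, sub_zero]
      rw [cyclicDiff_cyclicCochain]
      simp [listCobdry_cons, cyclicCochain]
    | succ q ih =>
      intro hq
      rw [← ih (by omega), ← sub_eq_zero, ← map_sub]
      refine cyclicDiff_zero_of_cyclicDiff (n := q + 1) ?_
      rw [map_sub, sub_eq_zero, ← joinEval_comp,
        show (fun l => cyclicDiff p (q + 1) (Ψ (q + 1) l)) = listCobdry (Ψ q) from
          funext (hΨdiff q)]
      rw [joinEval_listCobdry, ← joinEval_comp]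
      refine joinEval_congr w q fun l _ hl => ?_
      simp only [shiftDiff, hΨshift q (by omega) l hl, cyclicDiff]
      split_ifs <;> simp
  have hzero : joinEval w (n - 1) (Ψ (n - 1)) = 0 := by
    refine (joinEval_congr w (n - 1) fun l _ hl => ?_).trans (joinEval_zero w (n - 1))
    have h0 : subdivide (n - 1 + 1)
        (fun _ : List (Finset (ZMod p × Fin n)) => (0 : ZMod p → ZMod p)) l = 0 := by
      simpa using subdivide_sub (n - 1 + 1)
        (fun _ : List (Finset (ZMod p × Fin n)) => (0 : ZMod p → ZMod p)) (fun _ => 0) l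
    refine Eq.trans ?_ h0
    refine subdivide_congr fun L hlen hL hLl => ?_
    have hface : ∀ A ∈ L.toFinset, IsEFace p n A := fun A hA =>
      isEFace_of_subset_toFinset (hl ▸ hw (n - 1) (by omega)) (hLl A (List.mem_toFinset.1 hA)).1
        (hLl A (List.mem_toFinset.1 hA)).2
    refine (isAlternatingOnLists_cyclicCochain g (fun l l' h => ?_) _).eq_zero fun hnd => ?_
    · simp only [g]
      rw [List.toFinset_eq_of_perm _ _ h]
    · have hcard := List.toFinset_card_of_nodup hnd
      have himg : (L.map lam).toFinset = L.toFinset.image lam := by ext; simp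
      have hle : #(L.toFinset.image lam) ≤ α + t * (p - 1) := by
        refine card_le_of_card_fiber_le ?_
          (fun j hj => card_label_fiber_le_one hface (hchain L hL) hlow hj)
          (card_label_fiber_lt hface (hchain L hL) hlow hhigh)
        simp only [Finset.mem_image]
        rintro _ ⟨A, hA, rfl⟩
        exact hrange A (hface A hA)
      rw [himg, List.length_map, hlen] at hcard
      omega
  have := hnorm (n - 1) (by omega)
  rw [hzero, map_zero] at this
  exact zero_ne_one this

end Tucker

/-! ### The labeling obtained from a coloring -/

section Labeling

variable {p n : ℕ}

/-- The label of `x` in the face `A`. -/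
def labelAt (A : Finset (ZMod p × Fin n)) (x : Fin n) : ZMod p :=
  ∑ y ∈ A.filter (fun y => y.2 = x), y.1

lemma labelAt_eq {A : Finset (ZMod p × Fin n)} (hA : IsEFace p n A) {i : ZMod p} {x : Fin n}
    (h : (i, x) ∈ A) : labelAt A x = i := by
  have : A.filter (fun y => y.2 = x) = {(i, x)} := by
    ext y
    simp only [Finset.mem_filter, Finset.mem_singleton]
    constructor
    · rintro ⟨hy, hyx⟩
      exact hA.2 y hy _ h hyx
    · rintro rfl
      exact ⟨h, rfl⟩
  simp [labelAt, this]

lemma mem_image_shift {A : Finset (ZMod p × Fin n)} {a i : ZMod p} {x : Fin n} :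
    (a + i, x) ∈ A.image (shift a) ↔ (i, x) ∈ A :=
  (shift_injective a).mem_finset_image (a := (i, x))

lemma IsEFace.image_shift {A : Finset (ZMod p × Fin n)} (hA : IsEFace p n A) (a : ZMod p) :
    IsEFace p n (A.image (shift a)) := by
  refine ⟨hA.1.image _, ?_⟩
  simp only [Finset.mem_image]
  rintro _ ⟨x, hx, rfl⟩ _ ⟨y, hy, rfl⟩ h
  rw [hA.2 x hx y hy h]

/-- The set of pairs (label, block index) occurring in the face `A`. -/
def profile (b : Fin n → ℕ) (A : Finset (ZMod p × Fin n)) : Finset (ZMod p × ℕ) :=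
  A.image (Prod.map id b)

lemma mem_profile {b : Fin n → ℕ} {A : Finset (ZMod p × Fin n)} {y : ZMod p × ℕ} :
    y ∈ profile b A ↔ ∃ x, (y.1, x) ∈ A ∧ b x = y.2 := by
  simp [profile, Prod.ext_iff]

lemma profile_shift (b : Fin n → ℕ) (a : ZMod p) (A : Finset (ZMod p × Fin n)) :
    profile b (A.image (shift a)) = (profile b A).image (shift a) := by
  simp only [profile, Finset.image_image]
  rfl

lemma exists_mem_of_le_card_fiber {b : Fin n → ℕ} (hb : ∀ j, #(univ.filter fun x => b x = j) ≤ p)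
    {A : Finset (ZMod p × Fin n)} (hA : IsEFace p n A) {j : ℕ}
    (h : p ≤ #((profile b A).filter fun y => y.2 = j)) {x : Fin n} (hx : b x = j) :
    ∃ i, (i, x) ∈ A := by
  have h₁ : p ≤ #(A.filter fun y => b y.2 = j) := by
    rw [profile, Finset.filter_image] at h
    exact h.trans Finset.card_image_le
  have h₂ : #((A.filter fun y => b y.2 = j).image Prod.snd) = #(A.filter fun y => b y.2 = j) :=
    Finset.card_image_of_injOn fun y hy z hz hyz =>
      hA.2 y (Finset.mem_filter.1 hy).1 z (Finset.mem_filter.1 hz).1 hyz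
  have h₃ : (A.filter fun y => b y.2 = j).image Prod.snd = univ.filter fun x => b x = j := by
    refine Finset.eq_of_subset_of_card_le ?_ ((hb j).trans (h₁.trans h₂.ge))
    intro z hz
    simp only [Finset.mem_image, Finset.mem_filter] at hz
    obtain ⟨y, ⟨-, hy⟩, rfl⟩ := hz
    simpa using hy
  have hmem : x ∈ (A.filter fun y => b y.2 = j).image Prod.snd := by simpa [h₃] using hx
  simp only [Finset.mem_image, Finset.mem_filter] at hmem
  obtain ⟨⟨i, _⟩, ⟨hy, -⟩, rfl⟩ := hmem
  exact ⟨i, hy⟩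

/-- The sign of a face read off from the first block it meets; `r j` is a fixed element of the
block with index `j`. -/
noncomputable def blockSign (b : Fin n → ℕ) (r : ℕ → Fin n) (A : Finset (ZMod p × Fin n)) :
    ZMod p :=
  if #(bottomFiber (profile b A)) < p then averageSign (profile b A)
  else labelAt A (r (bottomIndex (profile b A)))

variable {b : Fin n → ℕ} {r : ℕ → Fin n}

lemma exists_label_of_le_card_bottomFiber (hb : ∀ j, #(univ.filter fun x => b x = j) ≤ p)
    (hr : ∀ x, b (r (b x)) = b x) {A : Finset (ZMod p × Fin n)} (hA : IsEFace p n A)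
    (h : p ≤ #(bottomFiber (profile b A))) :
    ∃ i, (i, r (bottomIndex (profile b A))) ∈ A := by
  refine exists_mem_of_le_card_fiber hb hA h ?_
  obtain ⟨y, hy, hyj⟩ := exists_mem_eq_bottomIndex (s := profile b A) (hA.1.image _)
  obtain ⟨x, -, hx⟩ := mem_profile.1 hy
  rw [← hyj, ← hx, hr]

lemma blockSign_shift [Fact p.Prime] (hb : ∀ j, #(univ.filter fun x => b x = j) ≤ p)
    (hr : ∀ x, b (r (b x)) = b x) {A : Finset (ZMod p × Fin n)} (hA : IsEFace p n A)
    (a : ZMod p) : blockSign b r (A.image (shift a)) = a + blockSign b r A := by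
  simp only [blockSign, profile_shift, bottomFiber_shift, bottomIndex_shift,
    Finset.card_image_of_injective _ (shift_injective a)]
  split_ifs with h
  · exact averageSign_shift a (hA.1.image _) h
  · obtain ⟨i, hi⟩ := exists_label_of_le_card_bottomFiber hb hr hA (not_lt.1 h)
    rw [labelAt_eq hA hi, labelAt_eq (hA.image_shift a) (mem_image_shift.2 hi)]

lemma blockSign_eq_of_subset (hb : ∀ j, #(univ.filter fun x => b x = j) ≤ p)
    (hr : ∀ x, b (r (b x)) = b x) {A₁ A₂ : Finset (ZMod p × Fin n)} (h₁ : IsEFace p n A₁)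
    (h₂ : IsEFace p n A₂) (hA : A₁ ⊆ A₂) (hcard : #(profile b A₁) = #(profile b A₂)) :
    blockSign b r A₁ = blockSign b r A₂ := by
  have hprof : profile b A₁ = profile b A₂ :=
    Finset.eq_of_subset_of_card_le (Finset.image_subset_image hA) hcard.ge
  simp only [blockSign, ← hprof]
  split_ifs with h
  · rfl
  · obtain ⟨i, hi⟩ := exists_label_of_le_card_bottomFiber hb hr h₁ (not_lt.1 h)
    rw [labelAt_eq h₁ hi, labelAt_eq h₂ (hA hi)]

lemma exists_vertex_of_lt_card_profile [NeZero p] {k l : ℕ}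
    {P : Fin l → Finset (Fin n)} (hbP : ∀ x j, x ∈ P j → b x = j)
    {A : Finset (ZMod p × Fin n)} (h : p * (k - 1) < #(profile b A)) :
    ∃ F : KGPVertex n k l P, ∃ i, ∀ x ∈ F.1, (i, x) ∈ A := by
  obtain ⟨i, -, hi⟩ := Finset.exists_lt_card_fiber_of_mul_lt_card_of_maps_to
    (s := profile b A) (t := univ) (f := Prod.fst) (n := k - 1) (by simp)
    (by simpa [ZMod.card] using h)
  obtain ⟨T, hT, hTk⟩ := Finset.exists_subset_card_eq (n := k) (Nat.le_of_pred_lt hi)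
  have hex : ∀ y ∈ T, ∃ x, (i, x) ∈ A ∧ b x = y.2 := fun y hy => by
    obtain ⟨hy, rfl⟩ := Finset.mem_filter.1 (hT hy)
    exact mem_profile.1 hy
  have : Nonempty (Fin n) := by
    obtain ⟨y, hy⟩ := Finset.card_pos.1 ((Nat.zero_le _).trans_lt h)
    exact (mem_profile.1 hy).nonempty
  choose! f hfA hfb using hex
  have hinj : ∀ y ∈ T, ∀ z ∈ T, b (f y) = b (f z) → y = z := fun y hy z hz hyz => by
    rw [hfb y hy, hfb z hz] at hyz
    exact Prod.ext ((Finset.mem_filter.1 (hT hy)).2.trans (Finset.mem_filter.1 (hT hz)).2.symm)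
      hyz
  refine ⟨⟨T.image f, ?_, fun j => ?_⟩, i, ?_⟩
  · rw [Finset.card_image_of_injOn fun y hy z hz hyz => hinj y hy z hz (congrArg b hyz), hTk]
  · rw [Finset.card_le_one]
    simp only [Finset.mem_inter, Finset.mem_image]
    rintro _ ⟨⟨y, hy, rfl⟩, hyj⟩ _ ⟨⟨z, hz, rfl⟩, hzj⟩
    rw [hinj y hy z hz ((hbP _ _ hyj).trans (hbP _ _ hzj).symm)]
  · simp only [Finset.mem_image]
    rintro _ ⟨y, hy, rfl⟩
    exact hfA y hy

open Classical in
/-- The value of `f` at a chosen element satisfying `Q`, or `d` if there is none. -/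
noncomputable def chooseOrElse {V β : Type*} (Q : V → Prop) (f : V → β) (d : β) : β :=
  if h : ∃ v, Q v then f h.choose else d

lemma exists_chooseOrElse_eq {V : Type*} (β : Type*) {Q : V → Prop} (h : ∃ v, Q v) :
    ∃ v, Q v ∧ ∀ (f : V → β) d, chooseOrElse Q f d = f v :=
  ⟨h.choose, h.choose_spec, fun _ _ => dif_pos h⟩

lemma chooseOrElse_of_not {V β : Type*} {Q : V → Prop} (h : ¬ ∃ v, Q v) (f : V → β) (d : β) :
    chooseOrElse Q f d = d := dif_neg h

theorem exists_tucker_labeling [Fact p.Prime] {k l t : ℕ} (hk : 1 ≤ k)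
    {P : Fin l → Finset (Fin n)} (hb : ∀ j, #(univ.filter fun x => b x = j) ≤ p)
    (hr : ∀ x, b (r (b x)) = b x) (hbP : ∀ x j, x ∈ P j → b x = j)
    (c : KGPVertex n k l P → Fin t) (hc : IsProperColoring (KGPEdges n k l p P) c) :
    ∃ lam : Finset (ZMod p × Fin n) → ZMod p × ℕ,
      (∀ A, IsEFace p n A → 1 ≤ (lam A).2 ∧ (lam A).2 ≤ p * (k - 1) + t) ∧
      (∀ ω : ZMod p, ∀ A, IsEFace p n A →
        lam (ESmul p n ω A) = (ω + (lam A).1, (lam A).2)) ∧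
      (∀ A₁ A₂, IsEFace p n A₁ → IsEFace p n A₂ → A₁ ⊆ A₂ →
        (lam A₁).2 = (lam A₂).2 → (lam A₁).2 ≤ p * (k - 1) → (lam A₁).1 = (lam A₂).1) ∧
      (∀ A : Fin p → Finset (ZMod p × Fin n),
        (∀ j, IsEFace p n (A j)) → (∀ i j, i ≤ j → A i ⊆ A j) →
        (∀ i j, (lam (A i)).2 = (lam (A j)).2) → (∀ j, p * (k - 1) < (lam (A j)).2) →
        ¬ Function.Injective (fun j => (lam (A j)).1)) := by
  have hne : ∀ F : KGPVertex n k l P, ∃ x, x ∈ F.1 := fun F =>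
    Finset.card_pos.1 (by rw [F.2.1]; omega)
  choose pt hpt using hne
  let Q : Finset (ZMod p × Fin n) → KGPVertex n k l P → Prop :=
    fun A F => ∃ i, ∀ x ∈ F.1, (i, x) ∈ A
  let lam : Finset (ZMod p × Fin n) → ZMod p × ℕ := fun A =>
    chooseOrElse (Q A) (fun F => (labelAt A (pt F), p * (k - 1) + 1 + c F))
      (blockSign b r A, #(profile b A))
  have hQshift : ∀ A (ω : ZMod p), Q (A.image (shift ω)) = Q A := by
    intro A ω
    funext F
    refine propext ⟨fun ⟨i, hi⟩ => ⟨i - ω, fun x hx => ?_⟩, fun ⟨i, hi⟩ => ⟨ω + i, fun x hx => ?_⟩⟩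
    · rw [← mem_image_shift (a := ω), add_sub_cancel]
      exact hi x hx
    · exact mem_image_shift.2 (hi x hx)
  have hhigh : ∀ A, IsEFace p n A → (∃ F, Q A F) → ∃ F i, (∀ x ∈ F.1, (i, x) ∈ A) ∧
      lam A = (i, p * (k - 1) + 1 + c F) := by
    intro A hA hQ
    obtain ⟨F, ⟨i, hi⟩, hF⟩ := exists_chooseOrElse_eq (ZMod p × ℕ) hQ
    exact ⟨F, i, hi, by rw [← labelAt_eq hA (hi _ (hpt F))]; exact hF _ _⟩
  have hlow : ∀ A, (¬ ∃ F, Q A F) → lam A = (blockSign b r A, #(profile b A)) ∧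
      #(profile b A) ≤ p * (k - 1) := fun A hQ =>
    ⟨chooseOrElse_of_not hQ _ _,
      not_lt.1 fun h => hQ (exists_vertex_of_lt_card_profile hbP h)⟩
  refine ⟨lam, fun A hA => ?_, fun ω A hA => ?_, fun A₁ A₂ h₁ h₂ hA heq hle => ?_,
    fun A hA hmono heq hlt hinj => ?_⟩
  · by_cases hQ : ∃ F, Q A F
    · obtain ⟨F, i, -, h⟩ := hhigh A hA hQ
      have := (c F).isLt
      rw [h]
      exact ⟨by simp only; omega, by simp only; omega⟩
    · obtain ⟨h, hle⟩ := hlow A hQ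
      rw [h]
      exact ⟨Finset.card_pos.2 (hA.1.image _), by simp only; omega⟩
  · change lam (A.image (shift ω)) = _
    by_cases hQ : ∃ F, Q A F
    · obtain ⟨F, ⟨i, hi⟩, hF⟩ := exists_chooseOrElse_eq (ZMod p × ℕ) hQ
      simp only [lam]
      rw [hQshift, hF, hF, labelAt_eq hA (hi _ (hpt F)),
        labelAt_eq (hA.image_shift ω) (mem_image_shift.2 (hi _ (hpt F)))]
    · rw [(hlow A hQ).1, (hlow (A.image (shift ω)) (by rwa [hQshift])).1,
        blockSign_shift hb hr hA, profile_shift,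
        Finset.card_image_of_injective _ (shift_injective ω)]
  · have hno : ∀ A, IsEFace p n A → (lam A).2 ≤ p * (k - 1) → ¬ ∃ F, Q A F := by
      intro A hA hle hQ
      obtain ⟨F, i, -, h⟩ := hhigh A hA hQ
      rw [h] at hle
      simp only at hle
      omega
    have e₁ := (hlow A₁ (hno A₁ h₁ hle)).1
    have e₂ := (hlow A₂ (hno A₂ h₂ (heq ▸ hle))).1
    rw [e₁, e₂] at heq ⊢
    exact blockSign_eq_of_subset hb hr h₁ h₂ hA heq
  · have hQ : ∀ j, ∃ F, Q (A j) F := fun j => by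
      by_contra hQ
      have := hlt j
      rw [(hlow _ hQ).1] at this
      exact absurd this (not_lt.2 (hlow _ hQ).2)
    choose F i hFi hlam using fun j => hhigh (A j) (hA j) (hQ j)
    have hi : Function.Injective i := by simpa [hlam] using hinj
    have hcF : ∀ j j', c (F j) = c (F j') := fun j j' => by
      have := heq j j'
      simp only [hlam, add_right_inj] at this
      exact Fin.ext this
    have hmem : ∀ j j' x, x ∈ (F j).1 → x ∈ (F j').1 → j = j' := by
      intro j j' x hx hx'
      rcases le_total j j' with h | h
      · exact hi (congrArg Prod.fst
          ((hA j').2 _ (hmono j j' h (hFi j x hx)) _ (hFi j' x hx') rfl))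
      · exact hi (congrArg Prod.fst
          ((hA j).2 _ (hFi j x hx) _ (hmono j' j h (hFi j' x hx')) rfl))
    have hedge : (univ : Finset (Fin p)).val.map F ∈ KGPEdges n k l p P := by
      refine ⟨by simp, Finset.univ.nodup.map fun j j' h => hmem j j' _ (hpt _) (h ▸ hpt _), ?_⟩
      simp only [Multiset.mem_map]
      rintro _ ⟨j, -, rfl⟩ _ ⟨j', -, rfl⟩ hne
      rw [Finset.disjoint_left]
      intro x hx hx'
      exact hne (congrArg F (hmem j j' x hx hx'))
    obtain ⟨_, ha, _, hb', hne⟩ := hc _ hedge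
    obtain ⟨j, -, rfl⟩ := Multiset.mem_map.1 ha
    obtain ⟨j', -, rfl⟩ := Multiset.mem_map.1 hb'
    exact hne (hcF j j')

end Labeling

/-- From any proper coloring `c` of `KG^p(n,k,P)` with `t` colors one obtains a
`ℤ_p`-equivariant labeling `λ` of the non-empty faces of `E_{n-1}(ℤ_p)` satisfying the
hypotheses of the `ℤ_p`-Tucker lemma with `α = p(k-1)` and `m = p(k-1)+t`; consequently
`t ≥ (n - p(k-1))/(p-1)`. -/
theorem tucker_labeling_from_coloring (p n k l t : ℕ) (hp : p.Prime)
    (hk : 1 ≤ k) (hn : p * k ≤ n)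
    (P : Fin l → Finset (Fin n)) (hP : IsPartition n l P) (hPp : ∀ j, (P j).card ≤ p)
    (c : KGPVertex n k l P → Fin t)
    (hc : IsProperColoring (KGPEdges n k l p P) c) :
    (∃ lam : Finset (ZMod p × Fin n) → ZMod p × ℕ,
      (∀ A, IsEFace p n A → 1 ≤ (lam A).2 ∧ (lam A).2 ≤ p * (k - 1) + t) ∧
      (∀ ω : ZMod p, ∀ A, IsEFace p n A →
        lam (ESmul p n ω A) = (ω + (lam A).1, (lam A).2)) ∧
      (∀ A₁ A₂, IsEFace p n A₁ → IsEFace p n A₂ → A₁ ⊆ A₂ →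
        (lam A₁).2 = (lam A₂).2 → (lam A₁).2 ≤ p * (k - 1) → (lam A₁).1 = (lam A₂).1) ∧
      (∀ A : Fin p → Finset (ZMod p × Fin n),
        (∀ j, IsEFace p n (A j)) → (∀ i j, i ≤ j → A i ⊆ A j) →
        (∀ i j, (lam (A i)).2 = (lam (A j)).2) → (∀ j, p * (k - 1) < (lam (A j)).2) →
        ¬ Function.Injective (fun j => (lam (A j)).1))) ∧
    ((n : ℚ) - p * (k - 1)) / ((p : ℚ) - 1) ≤ (t : ℚ) := by
  have : Fact p.Prime := ⟨hp⟩
  have hp2 := hp.two_le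
  have hn0 : 0 < n := by nlinarith
  have : Nonempty (Fin n) := ⟨⟨0, hn0⟩⟩
  choose block hblock hunique using hP.2
  let b : Fin n → ℕ := fun x => block x
  have hbP : ∀ x j, x ∈ P j → b x = j := fun x j hx => congrArg Fin.val (hunique x j hx).symm
  have hb : ∀ j, #(univ.filter fun x => b x = j) ≤ p := by
    intro j
    rcases (univ.filter fun x => b x = j).eq_empty_or_nonempty with h | ⟨x, hx⟩
    · simp [h]
    · refine (Finset.card_le_card fun y hy => ?_).trans (hPp (block x))
      have hxy : block y = block x :=
        Fin.ext ((Finset.mem_filter.1 hy).2.trans (Finset.mem_filter.1 hx).2.symm)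
      exact hxy ▸ hblock y
  have hr : ∀ x, b (Function.invFun b (b x)) = b x := fun x => Function.invFun_eq ⟨x, rfl⟩
  have hlam := exists_tucker_labeling hk hb hr hbP c hc
  refine ⟨hlam, ?_⟩
  obtain ⟨lam, h₁, h₂, h₃, h₄⟩ := hlam
  have key : (n : ℚ) ≤ (p * (k - 1) + t * (p - 1) : ℕ) := by
    exact_mod_cast le_of_zmod_tucker_labeling h₁ h₂ h₃ h₄
  push_cast [Nat.cast_sub hk, Nat.cast_sub hp.one_le] at key
  have hp1 : (0 : ℚ) < p - 1 := sub_pos.2 (by exact_mod_cast hp.one_lt)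
  rw [div_le_iff₀ hp1]
  linarith
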